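/- arXiv:2001.05138 — 2 statements merged into one kernel-verified Lean document; each statement's English description precedes it below -/
import Mathlib

section
/- For every n ≥ 4, χ_la(Sp(2^[n])) ≥ n + 2, where Sp(2^[n]) is the tree obtained from the star K_{1,n} by subdividing each edge once. -/
open Finset
open scoped Classical

namespace LocalAntimagic

variable {V : Type*}

/-- The induced vertex label: sum of the labels of edges incident to `v`. -/
noncomputable def vertexSum [Fintype V] (G : SimpleGraph V) (f : Sym2 V → ℕ) (v : V) : ℕ :=
  ∑ e ∈ G.incidenceFinset v, f e

/-- `f` is a local antimagic labeling of `G`: a bijection from the edge set onto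
`{1, …, |E|}` whose induced vertex labels distinguish adjacent vertices. -/
def IsLocalAntimagic [Fintype V] (G : SimpleGraph V) (f : Sym2 V → ℕ) : Prop :=
  Set.BijOn f G.edgeSet (Set.Icc 1 G.edgeFinset.card) ∧
  ∀ ⦃u v : V⦄, G.Adj u v → vertexSum G f u ≠ vertexSum G f v

/-- The color number `c(f)`: the number of distinct induced vertex labels. -/
noncomputable def colorCount [Fintype V] (G : SimpleGraph V) (f : Sym2 V → ℕ) : ℕ :=
  (Finset.univ.image (vertexSum G f)).card

/-- The local antimagic chromatic number. -/
noncomputable def chiLA [Fintype V] (G : SimpleGraph V) : ℕ :=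
  sInf {n | ∃ f, IsLocalAntimagic G f ∧ colorCount G f = n}

/-- A pendant vertex is a vertex of degree 1. -/
def IsPendant [Fintype V] (G : SimpleGraph V) (v : V) : Prop :=
  G.degree v = 1

/-- The number of pendant vertices of `G`. -/
noncomputable def pendantCount [Fintype V] (G : SimpleGraph V) : ℕ :=
  (Finset.univ.filter (fun v => IsPendant G v)).card

/-- Vertices of the spider `Sp(2^[n])`: a core vertex `u`, the middle vertices `vᵢ`,
and the pendant (leaf) vertices `wᵢ`. -/
inductive SpVert (n : ℕ) : Type
  | core : SpVert n
  | mid (i : Fin n) : SpVert n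
  | leaf (i : Fin n) : SpVert n
  deriving DecidableEq, Fintype

/-- The spider `Sp(2^[n])`: the star `K_{1,n}` with every edge subdivided once.
The core is adjacent to each `vᵢ`, and each `vᵢ` is adjacent to the pendant `wᵢ`. -/
def spider2 (n : ℕ) : SimpleGraph (SpVert n) :=
  SimpleGraph.fromRel (fun a b =>
    (∃ i : Fin n, a = SpVert.core ∧ b = SpVert.mid i) ∨
    (∃ i : Fin n, a = SpVert.mid i ∧ b = SpVert.leaf i))

theorem spider2_adj_core_mid {n : ℕ} (i : Fin n) :
    (spider2 n).Adj SpVert.core (SpVert.mid i) := by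
  simp [spider2]

theorem spider2_adj_mid_leaf {n : ℕ} (i : Fin n) :
    (spider2 n).Adj (SpVert.mid i) (SpVert.leaf i) := by
  simp [spider2]

theorem mem_edgeSet_spider2 {n : ℕ} (e : Sym2 (SpVert n)) :
    e ∈ (spider2 n).edgeSet ↔
      (∃ i, e = s(SpVert.core, SpVert.mid i)) ∨ ∃ i, e = s(SpVert.mid i, SpVert.leaf i) := by
  induction e with
  | _ a b => cases a <;> cases b <;> simp [spider2, eq_comm]

theorem card_edgeFinset_spider2 (n : ℕ) : (spider2 n).edgeFinset.card = 2 * n := by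
  have h : (spider2 n).edgeFinset =
      univ.image (fun i : Fin n => s(SpVert.core, SpVert.mid i)) ∪
        univ.image (fun i : Fin n => s(SpVert.mid i, SpVert.leaf i)) := by
    ext e
    simp [mem_edgeSet_spider2, eq_comm]
  rw [h, card_union_of_disjoint, card_image_of_injective, card_image_of_injective]
  · simp [two_mul]
  · intro i j; simp
  · intro i j; simp
  · simp [disjoint_left]

theorem vertexSum_eq_sum [Fintype V] {G : SimpleGraph V} (f : Sym2 V → ℕ) {v : V}
    {s : Finset (Sym2 V)} (hs : ∀ e, e ∈ G.edgeSet ∧ v ∈ e ↔ e ∈ s) :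
    vertexSum G f v = ∑ e ∈ s, f e := by
  refine sum_congr ?_ fun _ _ => rfl
  ext e
  rw [SimpleGraph.mem_incidenceFinset, ← hs]
  rfl

theorem vertexSum_core {n : ℕ} (f : Sym2 (SpVert n) → ℕ) :
    vertexSum (spider2 n) f SpVert.core = ∑ i, f s(SpVert.core, SpVert.mid i) := by
  rw [vertexSum_eq_sum f (s := univ.image fun i : Fin n => s(SpVert.core, SpVert.mid i)), sum_image]
  · intro i _ j _
    simp
  · intro e
    simp only [mem_edgeSet_spider2, mem_image, mem_univ, true_and]
    constructor
    · rintro ⟨⟨i, rfl⟩ | ⟨i, rfl⟩, h⟩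
      · exact ⟨i, rfl⟩
      · simp at h
    · rintro ⟨i, rfl⟩
      exact ⟨Or.inl ⟨i, rfl⟩, by simp⟩

theorem vertexSum_mid {n : ℕ} (f : Sym2 (SpVert n) → ℕ) (i : Fin n) :
    vertexSum (spider2 n) f (SpVert.mid i) =
      f s(SpVert.core, SpVert.mid i) + f s(SpVert.mid i, SpVert.leaf i) := by
  rw [vertexSum_eq_sum f (s := {s(SpVert.core, SpVert.mid i), s(SpVert.mid i, SpVert.leaf i)}),
    sum_pair (by simp)]
  intro e
  simp only [mem_edgeSet_spider2, mem_insert, mem_singleton]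
  constructor
  · rintro ⟨⟨j, rfl⟩ | ⟨j, rfl⟩, h⟩ <;> simp at h <;> simp [h]
  · rintro (rfl | rfl) <;> simp

theorem vertexSum_leaf {n : ℕ} (f : Sym2 (SpVert n) → ℕ) (i : Fin n) :
    vertexSum (spider2 n) f (SpVert.leaf i) = f s(SpVert.mid i, SpVert.leaf i) := by
  rw [vertexSum_eq_sum f (s := {s(SpVert.mid i, SpVert.leaf i)}), sum_singleton]
  intro e
  simp only [mem_edgeSet_spider2, mem_singleton]
  constructor
  · rintro ⟨⟨j, rfl⟩ | ⟨j, rfl⟩, h⟩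
    · simp at h
    · rw [show i = j by simpa using h]
  · rintro rfl
    simp

/-- Half the label weight carried by each vertex in an explicit labeling of the spider. -/
def spiderWeight (n : ℕ) : SpVert n → ℕ
  | .core => n
  | .mid i => i + 1
  | .leaf _ => 0

/-- The labeling of the spider with labels `1, …, n` on the pendant edges and
`n + 1, …, 2 * n` on the edges at the core. -/
def spiderLabeling (n : ℕ) : Sym2 (SpVert n) → ℕ :=
  Sym2.lift ⟨fun a b => spiderWeight n a + spiderWeight n b, fun _ _ => add_comm _ _⟩

theorem spiderLabeling_core_mid {n : ℕ} (i : Fin n) :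
    spiderLabeling n s(SpVert.core, SpVert.mid i) = n + (i + 1) := rfl

theorem spiderLabeling_mid_leaf {n : ℕ} (i : Fin n) :
    spiderLabeling n s(SpVert.mid i, SpVert.leaf i) = i + 1 := rfl

theorem bijOn_spiderLabeling (n : ℕ) :
    Set.BijOn (spiderLabeling n) (spider2 n).edgeSet (Set.Icc 1 (2 * n)) := by
  refine ⟨?_, ?_, ?_⟩
  · intro e he
    rw [mem_edgeSet_spider2] at he
    rcases he with ⟨i, rfl⟩ | ⟨i, rfl⟩ <;>
      simp only [spiderLabeling_core_mid, spiderLabeling_mid_leaf, Set.mem_Icc] <;> omega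
  · intro e he e' he' h
    rw [mem_edgeSet_spider2] at he he'
    rcases he with ⟨i, rfl⟩ | ⟨i, rfl⟩ <;> rcases he' with ⟨j, rfl⟩ | ⟨j, rfl⟩ <;>
      simp only [spiderLabeling_core_mid, spiderLabeling_mid_leaf] at h
    · rw [show i = j by omega]
    · omega
    · omega
    · rw [show i = j by omega]
  · rintro k ⟨hk, hk'⟩
    by_cases hkn : k ≤ n
    · refine ⟨s(SpVert.mid ⟨k - 1, by omega⟩, SpVert.leaf ⟨k - 1, by omega⟩), ?_, ?_⟩
      · exact spider2_adj_mid_leaf _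
      · rw [spiderLabeling_mid_leaf]
        dsimp only
        omega
    · refine ⟨s(SpVert.core, SpVert.mid ⟨k - n - 1, by omega⟩), ?_, ?_⟩
      · exact spider2_adj_core_mid _
      · rw [spiderLabeling_core_mid]
        dsimp only
        omega

theorem isLocalAntimagic_spiderLabeling {n : ℕ} (hn : 3 ≤ n) :
    IsLocalAntimagic (spider2 n) (spiderLabeling n) := by
  refine ⟨card_edgeFinset_spider2 n ▸ bijOn_spiderLabeling n, ?_⟩
  have hcore (i : Fin n) : vertexSum (spider2 n) (spiderLabeling n) SpVert.core ≠
      vertexSum (spider2 n) (spiderLabeling n) (SpVert.mid i) := by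
    have h : ∑ _i : Fin n, (n + 1) ≤ ∑ i : Fin n, (n + ((i : ℕ) + 1)) :=
      sum_le_sum fun i _ => by omega
    simp only [sum_const, card_univ, Fintype.card_fin, smul_eq_mul] at h
    simp only [vertexSum_core, vertexSum_mid, spiderLabeling_core_mid, spiderLabeling_mid_leaf]
    have := i.isLt
    nlinarith
  have hleaf (i : Fin n) : vertexSum (spider2 n) (spiderLabeling n) (SpVert.mid i) ≠
      vertexSum (spider2 n) (spiderLabeling n) (SpVert.leaf i) := by
    simp only [vertexSum_mid, vertexSum_leaf, spiderLabeling_core_mid, spiderLabeling_mid_leaf]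
    omega
  intro u v huv
  have he := (mem_edgeSet_spider2 s(u, v)).1 huv
  simp only [Sym2.eq_iff] at he
  rcases he with ⟨i, ⟨rfl, rfl⟩ | ⟨rfl, rfl⟩⟩ | ⟨i, ⟨rfl, rfl⟩ | ⟨rfl, rfl⟩⟩
  exacts [hcore i, (hcore i).symm, hleaf i, (hleaf i).symm]

/-- A sum of `n` distinct positive integers is at least `1 + ⋯ + n`. -/
theorem card_mul_succ_le_two_mul_sum (s : Finset ℕ) (hs : ∀ x ∈ s, 0 < x) :
    s.card * (s.card + 1) ≤ 2 * ∑ x ∈ s, x := by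
  induction s using Finset.induction_on_max with
  | empty => simp
  | insert a s ha ih =>
    have hmem : a ∉ s := fun h => lt_irrefl a (ha a h)
    have hcard : s.card + 1 ≤ a := by
      have hsub : insert a s ⊆ Icc 1 a := by
        intro x hx
        have := hs x hx
        rcases mem_insert.1 hx with rfl | hx
        · simp; omega
        · simp [(ha x hx).le]; omega
      simpa [card_insert_of_notMem hmem] using card_le_card hsub
    have := ih fun x hx => hs x (mem_insert_of_mem hx)
    rw [card_insert_of_notMem hmem, sum_insert hmem]
    nlinarith

theorem le_colorCount_spider2 {n : ℕ} (hn : 4 ≤ n) {f : Sym2 (SpVert n) → ℕ}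
    (hf : IsLocalAntimagic (spider2 n) f) : n + 2 ≤ colorCount (spider2 n) f := by
  obtain ⟨⟨hmaps, hinj, hsurj⟩, hne⟩ := hf
  rw [card_edgeFinset_spider2] at hmaps hsurj
  have hc (i : Fin n) : 1 ≤ f s(SpVert.core, SpVert.mid i) ∧
      f s(SpVert.core, SpVert.mid i) ≤ 2 * n := hmaps (spider2_adj_core_mid i)
  have hl (i : Fin n) : 1 ≤ f s(SpVert.mid i, SpVert.leaf i) ∧
      f s(SpVert.mid i, SpVert.leaf i) ≤ 2 * n := hmaps (spider2_adj_mid_leaf i)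
  obtain ⟨k, hk⟩ : ∃ k, 2 * n < vertexSum (spider2 n) f (SpVert.mid k) := by
    obtain ⟨e, he, hfe⟩ := hsurj (show 2 * n ∈ Set.Icc 1 (2 * n) by simp; omega)
    rcases (mem_edgeSet_spider2 e).1 he with ⟨i, rfl⟩ | ⟨i, rfl⟩ <;>
    · refine ⟨i, ?_⟩
      have := hc i
      have := hl i
      rw [vertexSum_mid]
      omega
  have hcore : 2 * n < vertexSum (spider2 n) f SpVert.core := by
    have hci : Function.Injective fun i : Fin n => f s(SpVert.core, SpVert.mid i) := fun i j h => by
      simpa using hinj (spider2_adj_core_mid i) (spider2_adj_core_mid j) h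
    have h := card_mul_succ_le_two_mul_sum
      (univ.image fun i : Fin n => f s(SpVert.core, SpVert.mid i)) fun x hx => by
        obtain ⟨i, -, rfl⟩ := mem_image.1 hx
        exact (hc i).1
    rw [card_image_of_injective _ hci, sum_image hci.injOn, card_univ, Fintype.card_fin,
      ← vertexSum_core] at h
    nlinarith
  have hli : Function.Injective fun i : Fin n => vertexSum (spider2 n) f (SpVert.leaf i) := by
    intro i j h
    simp only [vertexSum_leaf] at h
    simpa using hinj (spider2_adj_mid_leaf i) (spider2_adj_mid_leaf j) h
  set L := univ.image fun i : Fin n => vertexSum (spider2 n) f (SpVert.leaf i) with hL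
  have hnotMem {x : ℕ} (hx : 2 * n < x) : x ∉ L := by
    intro h
    obtain ⟨i, -, rfl⟩ := mem_image.1 h
    have := hl i
    rw [vertexSum_leaf] at hx
    omega
  have hcard : (insert (vertexSum (spider2 n) f SpVert.core)
      (insert (vertexSum (spider2 n) f (SpVert.mid k)) L)).card = n + 2 := by
    rw [card_insert_of_notMem, card_insert_of_notMem (hnotMem hk), hL,
      card_image_of_injective _ hli, card_univ, Fintype.card_fin]
    rw [mem_insert, not_or]
    exact ⟨hne (spider2_adj_core_mid k), hnotMem hcore⟩
  rw [← hcard, colorCount]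
  refine card_le_card ?_
  simp only [insert_subset_iff, hL, image_subset_iff, mem_image_of_mem _ (mem_univ _),
    implies_true, and_self]

/-- for every `n ≥ 4`, `χ_la(Sp(2^[n])) ≥ n + 2`. -/
theorem chiLA_spider2_lower (n : ℕ) (hn : 4 ≤ n) : n + 2 ≤ chiLA (spider2 n) := by
  refine le_csInf ⟨_, _, isLocalAntimagic_spiderLabeling (by omega), rfl⟩ ?_
  rintro _ ⟨f, hf, rfl⟩
  exact le_colorCount_spider2 hn hf

end LocalAntimagic
end

section
/- Assume the standard setup with r ≥ 2, and assume e + s·n₁ ≥ c_r, where s ≥ 1 if n₁ = 1 and s ≥ 2 is even if n₁ ≥ 2. If c₁ ≤ e < c₂, then χ_la(G(V₁,s)) = s·n₁ + t − r + 1. -/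
open Finset
open scoped Classical

namespace LocalAntimagic

variable {V : Type*}

/-- `G(S, s)`: the graph obtained from `G` by attaching `s` new pendant edges to every
vertex of `S`.  The new pendant vertex attached to `w ∈ S` via the `j`-th new edge is
`Sum.inr (w, j)`; the original graph lives on the `Sum.inl` vertices. -/
def attachPendants (G : SimpleGraph V) (S : Finset V) (s : ℕ) :
    SimpleGraph (V ⊕ (S × Fin s)) :=
  SimpleGraph.fromRel (fun a b =>
    (∃ u v : V, a = Sum.inl u ∧ b = Sum.inl v ∧ G.Adj u v) ∨
    (∃ (w : S) (j : Fin s), a = Sum.inl (w : V) ∧ b = Sum.inr (w, j)))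

/-- The standard setup: `G` is a connected graph with at least `2` edges and
`χ_la(G) = t ≥ 2`; `f` is a local antimagic labeling of `G` with `c(f) = t` whose color
classes are `Vset 1, …, Vset t` (each nonempty, with `f⁺ ≡ c i` on `Vset i`, and the
colors `c 1, …, c t` pairwise distinct); every non-pendant vertex lies in
`Vset 1 ∪ ⋯ ∪ Vset r` where `1 ≤ r ≤ t`; each `Vset i` with `r + 1 ≤ i ≤ t` is a
singleton consisting of a pendant vertex; `c 1 < c 2 < ⋯ < c r` and
`c (r+1) < c (r+2) < ⋯ < c t`. -/
structure StandardSetup [Fintype V] (G : SimpleGraph V) (f : Sym2 V → ℕ)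
    (t r : ℕ) (Vset : ℕ → Finset V) (c : ℕ → ℕ) : Prop where
  connected : G.Connected
  two_le_card_edges : 2 ≤ G.edgeFinset.card
  chiLA_eq : chiLA G = t
  two_le_t : 2 ≤ t
  antimagic : IsLocalAntimagic G f
  colorCount_eq : colorCount G f = t
  color_on_class : ∀ i ∈ Finset.Icc 1 t, ∀ v ∈ Vset i, vertexSum G f v = c i
  class_cover : ∀ v : V, ∃ i ∈ Finset.Icc 1 t, v ∈ Vset i
  class_nonempty : ∀ i ∈ Finset.Icc 1 t, (Vset i).Nonempty
  color_injective : ∀ i ∈ Finset.Icc 1 t, ∀ j ∈ Finset.Icc 1 t, i ≠ j → c i ≠ c j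
  one_le_r : 1 ≤ r
  r_le_t : r ≤ t
  nonpendant_mem : ∀ v : V, ¬ IsPendant G v → ∃ i ∈ Finset.Icc 1 r, v ∈ Vset i
  pendant_singleton : ∀ i ∈ Finset.Icc (r + 1) t, ∃ v : V, IsPendant G v ∧ Vset i = {v}
  c_strictMono_low : ∀ i j : ℕ, 1 ≤ i → i < j → j ≤ r → c i < c j
  c_strictMono_high : ∀ i j : ℕ, r + 1 ≤ i → i < j → j ≤ t → c i < c j

/-- `b`: the number of pendant vertices of `G` lying in `Vset 1 ∪ ⋯ ∪ Vset r`. -/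
noncomputable def pendantsInLow [Fintype V] (G : SimpleGraph V)
    (Vset : ℕ → Finset V) (r : ℕ) : ℕ :=
  (((Finset.Icc 1 r).biUnion Vset).filter (fun v => IsPendant G v)).card

section General

variable [Fintype V] {G : SimpleGraph V} {f : Sym2 V → ℕ}

lemma vertexSum_eq_sum_adj (G : SimpleGraph V) (f : Sym2 V → ℕ) (v : V) :
    vertexSum G f v = ∑ u, if G.Adj v u then f s(v, u) else 0 := by
  rw [← Finset.sum_filter]
  symm
  refine Finset.sum_bij (fun u _ => s(v, u)) ?_ ?_ ?_ fun _ _ => rfl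
  · intro u hu
    simpa [SimpleGraph.mk'_mem_incidenceSet_iff] using hu
  · intro a _ b _ h
    exact Sym2.congr_right.mp h
  · intro x hx
    induction x using Sym2.ind with
    | _ a b =>
      rw [SimpleGraph.mem_incidenceFinset, SimpleGraph.mk'_mem_incidenceSet_iff] at hx
      obtain ⟨hab, rfl | rfl⟩ := hx
      · exact ⟨b, by simpa using hab, rfl⟩
      · exact ⟨a, by simpa using hab.symm, Sym2.eq_swap⟩

lemma vertexSum_one (G : SimpleGraph V) (v : V) : vertexSum G (fun _ => 1) v = G.degree v := by
  simp [vertexSum]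

lemma le_vertexSum {u v : V} (h : G.Adj u v) : f s(u, v) ≤ vertexSum G f u :=
  Finset.single_le_sum (f := f) (fun _ _ => Nat.zero_le _)
    (by simpa [SimpleGraph.mk'_mem_incidenceSet_iff] using h)

lemma IsPendant.exists_vertexSum_eq {v : V} (hv : IsPendant G v) (f : Sym2 V → ℕ) :
    ∃ x ∈ G.edgeSet, v ∈ x ∧ vertexSum G f v = f x := by
  unfold IsPendant at hv
  rw [← SimpleGraph.card_incidenceFinset_eq_degree, Finset.card_eq_one] at hv
  obtain ⟨x, hx⟩ := hv
  have hmem : x ∈ G.incidenceSet v := by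
    rw [← SimpleGraph.mem_incidenceFinset, hx]; exact Finset.mem_singleton_self x
  exact ⟨x, hmem.1, hmem.2, by simp [vertexSum, hx]⟩

lemma IsLocalAntimagic.vertexSum_le_of_isPendant (hf : IsLocalAntimagic G f) {v : V}
    (hv : IsPendant G v) : vertexSum G f v ≤ G.edgeFinset.card := by
  obtain ⟨x, hx, -, h⟩ := hv.exists_vertexSum_eq f
  exact h ▸ (hf.1.mapsTo hx).2

lemma IsLocalAntimagic.lt_vertexSum (hf : IsLocalAntimagic G f) {u v : V} (huv : G.Adj u v)
    (hu : ¬ IsPendant G u) : f s(u, v) < vertexSum G f u := by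
  have hmem : s(u, v) ∈ G.incidenceFinset u := by
    simpa [SimpleGraph.mk'_mem_incidenceSet_iff] using huv
  have hcard : 1 < (G.incidenceFinset u).card := by
    have := Finset.card_pos.mpr ⟨_, hmem⟩
    rw [SimpleGraph.card_incidenceFinset_eq_degree] at this ⊢
    unfold IsPendant at hu
    omega
  obtain ⟨y, hy, hne⟩ := Finset.exists_mem_ne hcard s(u, v)
  refine Finset.single_lt_sum hne hmem hy ?_ fun _ _ _ => Nat.zero_le _
  exact (hf.1.mapsTo ((SimpleGraph.mem_incidenceFinset ..).mp hy).1).1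

lemma IsLocalAntimagic.injOn_vertexSum_isPendant (hf : IsLocalAntimagic G f) :
    Set.InjOn (vertexSum G f) {v | IsPendant G v} := by
  intro v hv w hw h
  obtain ⟨x, hx, hvx, hsx⟩ := IsPendant.exists_vertexSum_eq hv f
  obtain ⟨y, hy, hwy, hsy⟩ := IsPendant.exists_vertexSum_eq hw f
  obtain rfl : x = y := hf.1.injOn hx hy (by rw [← hsx, ← hsy, h])
  by_contra hne
  rw [(Sym2.mem_and_mem_iff hne).mp ⟨hvx, hwy⟩] at hx
  exact hf.2 hx h

/-- Every local antimagic labeling uses a color for each pendant vertex and at least one more. -/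
lemma IsLocalAntimagic.pendantCount_lt_colorCount (hf : IsLocalAntimagic G f)
    (hG : 1 ≤ G.edgeFinset.card) : pendantCount G < colorCount G f := by
  obtain ⟨w, hw⟩ : ∃ w, G.edgeFinset.card < vertexSum G f w := by
    obtain ⟨x, hx, hfx⟩ := hf.1.surjOn ⟨hG, le_rfl⟩
    induction x using Sym2.ind with
    | _ u v =>
      have huv : G.Adj u v := hx
      by_cases hu : IsPendant G u
      · by_cases hv : IsPendant G v
        · refine absurd ?_ (hf.2 huv)
          have h₁ := le_vertexSum (f := f) huv
          have h₂ := le_vertexSum (f := f) huv.symm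
          rw [Sym2.eq_swap] at h₂
          have h₃ := hf.vertexSum_le_of_isPendant hu
          have h₄ := hf.vertexSum_le_of_isPendant hv
          omega
        · refine ⟨v, hfx ▸ ?_⟩
          rw [Sym2.eq_swap]
          exact hf.lt_vertexSum huv.symm hv
      · exact ⟨u, hfx ▸ hf.lt_vertexSum huv hu⟩
  have hcard : pendantCount G
      = ((Finset.univ.filter fun v => IsPendant G v).image (vertexSum G f)).card := by
    rw [Finset.card_image_of_injOn (by simpa using hf.injOn_vertexSum_isPendant)]
    rfl
  rw [hcard, colorCount]
  refine Finset.card_lt_card ⟨Finset.image_subset_image (Finset.filter_subset _ _), fun h => ?_⟩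
  obtain ⟨v, hv, hvw⟩ := Finset.mem_image.mp (h (Finset.mem_image_of_mem _ (Finset.mem_univ w)))
  have := hf.vertexSum_le_of_isPendant (Finset.mem_filter.mp hv).2
  omega

lemma IsLocalAntimagic.chiLA_eq (hf : IsLocalAntimagic G f) (hG : 1 ≤ G.edgeFinset.card) {k : ℕ}
    (hub : colorCount G f ≤ k + 1) (hlb : k ≤ pendantCount G) : chiLA G = k + 1 := by
  refine le_antisymm (le_trans (Nat.sInf_le ⟨f, hf, rfl⟩) hub) ?_
  refine le_csInf ⟨colorCount G f, f, hf, rfl⟩ ?_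
  rintro _ ⟨g, hg, rfl⟩
  exact hlb.trans_lt (hg.pendantCount_lt_colorCount hG)

end General

section AttachPendants

variable {G : SimpleGraph V} {S : Finset V} {s : ℕ}

@[simp]
lemma attachPendants_adj_inl_inl {u v : V} :
    (attachPendants G S s).Adj (Sum.inl u) (Sum.inl v) ↔ G.Adj u v := by
  simp only [attachPendants, SimpleGraph.fromRel_adj]
  constructor
  · rintro ⟨-, (⟨a, b, ha, hb, h⟩ | ⟨_, _, _, h⟩) | (⟨a, b, ha, hb, h⟩ | ⟨_, _, _, h⟩)⟩
    · cases ha; cases hb; exact h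
    · cases h
    · cases ha; cases hb; exact h.symm
    · cases h
  · intro h
    exact ⟨fun h' => h.ne (Sum.inl_injective h'), Or.inl (Or.inl ⟨u, v, rfl, rfl, h⟩)⟩

@[simp]
lemma attachPendants_adj_inl_inr {u : V} {p : S × Fin s} :
    (attachPendants G S s).Adj (Sum.inl u) (Sum.inr p) ↔ (p.1 : V) = u := by
  simp only [attachPendants, SimpleGraph.fromRel_adj]
  constructor
  · rintro ⟨-, (⟨_, _, _, h, _⟩ | ⟨w, j, hw, h⟩) | (⟨_, _, h, _⟩ | ⟨_, _, h, _⟩)⟩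
    · cases h
    · cases hw; cases h; rfl
    · cases h
    · cases h
  · rintro rfl
    exact ⟨Sum.inl_ne_inr, Or.inl (Or.inr ⟨p.1, p.2, rfl, rfl⟩)⟩

@[simp]
lemma attachPendants_adj_inr_inl {u : V} {p : S × Fin s} :
    (attachPendants G S s).Adj (Sum.inr p) (Sum.inl u) ↔ (p.1 : V) = u := by
  rw [SimpleGraph.adj_comm, attachPendants_adj_inl_inr]

@[simp]
lemma not_attachPendants_adj_inr_inr {p q : S × Fin s} :
    ¬ (attachPendants G S s).Adj (Sum.inr p) (Sum.inr q) := by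
  simp [attachPendants]

lemma mem_edgeSet_attachPendants {x : Sym2 (V ⊕ (S × Fin s))} :
    x ∈ (attachPendants G S s).edgeSet ↔
      (∃ y ∈ G.edgeSet, x = Sym2.map Sum.inl y) ∨
        ∃ p : S × Fin s, x = s(Sum.inl (p.1 : V), Sum.inr p) := by
  constructor
  · induction x using Sym2.ind with
    | _ a b =>
      rw [SimpleGraph.mem_edgeSet]
      rcases a with u | p <;> rcases b with v | q <;> intro h
      · exact Or.inl ⟨s(u, v), attachPendants_adj_inl_inl.mp h, rfl⟩
      · rw [attachPendants_adj_inl_inr] at h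
        exact Or.inr ⟨q, by rw [h]⟩
      · rw [attachPendants_adj_inr_inl] at h
        exact Or.inr ⟨p, by rw [h, Sym2.eq_swap]⟩
      · exact absurd h not_attachPendants_adj_inr_inr
  · rintro (⟨y, hy, rfl⟩ | ⟨p, rfl⟩)
    · induction y using Sym2.ind with
      | _ u v => exact attachPendants_adj_inl_inl.mpr hy
    · exact attachPendants_adj_inl_inr.mpr rfl

/-- Extend an edge labeling of `G` to `attachPendants G S s`, labeling the new edges by `ℓ`. -/
def extendLabeling (f : Sym2 V → ℕ) (ℓ : S × Fin s → ℕ) : Sym2 (V ⊕ (S × Fin s)) → ℕ :=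
  Sym2.lift ⟨fun a b => match a, b with
    | Sum.inl u, Sum.inl v => f s(u, v)
    | Sum.inl _, Sum.inr p => ℓ p
    | Sum.inr p, Sum.inl _ => ℓ p
    | Sum.inr _, Sum.inr _ => 0, by
    rintro (u | p) (v | q)
    · exact congrArg f Sym2.eq_swap
    all_goals rfl⟩

variable {f : Sym2 V → ℕ} {ℓ : S × Fin s → ℕ}

lemma extendLabeling_comp_map : extendLabeling f ℓ ∘ Sym2.map Sum.inl = f := by
  ext x
  induction x using Sym2.ind with
  | _ u v => rfl

lemma bijOn_extendLabeling {e N : ℕ}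
    (hf : Set.BijOn f G.edgeSet (Set.Icc 1 e)) (hℓ : Set.BijOn ℓ Set.univ (Set.Icc (e + 1) N))
    (hN : e ≤ N) :
    Set.BijOn (extendLabeling f ℓ) (attachPendants G S s).edgeSet (Set.Icc 1 N) := by
  have hmap (y : Sym2 V) : extendLabeling f ℓ (Sym2.map Sum.inl y) = f y :=
    congrFun extendLabeling_comp_map y
  have hnew (p : S × Fin s) : extendLabeling f ℓ s(Sum.inl (p.1 : V), Sum.inr p) = ℓ p := rfl
  refine ⟨fun x hx => ?_, fun x hx y hy hxy => ?_, fun k hk => ?_⟩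
  · obtain ⟨y, hy, rfl⟩ | ⟨p, rfl⟩ := mem_edgeSet_attachPendants.mp hx
    · have := hf.mapsTo hy
      rw [hmap]
      exact ⟨this.1, this.2.trans hN⟩
    · have := hℓ.mapsTo (Set.mem_univ p)
      rw [hnew]
      exact ⟨by have := this.1; omega, this.2⟩
  · obtain ⟨x, hx', rfl⟩ | ⟨p, rfl⟩ := mem_edgeSet_attachPendants.mp hx <;>
      obtain ⟨y, hy', rfl⟩ | ⟨q, rfl⟩ := mem_edgeSet_attachPendants.mp hy
    · rw [hmap, hmap] at hxy
      rw [hf.injOn hx' hy' hxy]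
    · rw [hmap, hnew] at hxy
      have h₁ := (hf.mapsTo hx').2
      have h₂ := (hℓ.mapsTo (Set.mem_univ q)).1
      omega
    · rw [hmap, hnew] at hxy
      have h₁ := (hf.mapsTo hy').2
      have h₂ := (hℓ.mapsTo (Set.mem_univ p)).1
      omega
    · rw [hℓ.injOn (Set.mem_univ p) (Set.mem_univ q) hxy]
  · by_cases hke : k ≤ e
    · obtain ⟨y, hy, rfl⟩ := hf.surjOn ⟨hk.1, hke⟩
      exact ⟨_, mem_edgeSet_attachPendants.mpr (Or.inl ⟨y, hy, rfl⟩), hmap y⟩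
    · obtain ⟨p, -, rfl⟩ := hℓ.surjOn ⟨not_le.mp hke, hk.2⟩
      exact ⟨_, mem_edgeSet_attachPendants.mpr (Or.inr ⟨p, rfl⟩), hnew p⟩

variable [Fintype V]

lemma vertexSum_attachPendants_inl (g : Sym2 (V ⊕ (S × Fin s)) → ℕ) (v : V) :
    vertexSum (attachPendants G S s) g (Sum.inl v) =
      vertexSum G (g ∘ Sym2.map Sum.inl) v +
        ∑ p : S × Fin s, if (p.1 : V) = v then g s(Sum.inl v, Sum.inr p) else 0 := by
  simp [vertexSum_eq_sum_adj]

lemma vertexSum_attachPendants_inl_of_mem (g : Sym2 (V ⊕ (S × Fin s)) → ℕ) (w : S) :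
    vertexSum (attachPendants G S s) g (Sum.inl w) =
      vertexSum G (g ∘ Sym2.map Sum.inl) w +
        ∑ j, g s(Sum.inl (w : V), Sum.inr (w, j)) := by
  rw [vertexSum_attachPendants_inl, Fintype.sum_prod_type]
  congr 1
  rw [Finset.sum_eq_single w]
  · simp
  · intro b _ hb
    simp [Subtype.coe_injective.ne hb]
  · simp

lemma vertexSum_attachPendants_inl_of_notMem (g : Sym2 (V ⊕ (S × Fin s)) → ℕ) {v : V}
    (hv : v ∉ S) :
    vertexSum (attachPendants G S s) g (Sum.inl v) = vertexSum G (g ∘ Sym2.map Sum.inl) v := by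
  rw [vertexSum_attachPendants_inl, Finset.sum_eq_zero, add_zero]
  rintro ⟨w, j⟩ -
  exact if_neg fun h : (w : V) = v => hv (h ▸ w.2)

lemma vertexSum_attachPendants_inr (g : Sym2 (V ⊕ (S × Fin s)) → ℕ) (p : S × Fin s) :
    vertexSum (attachPendants G S s) g (Sum.inr p) = g s(Sum.inl (p.1 : V), Sum.inr p) := by
  simp [vertexSum_eq_sum_adj, Sym2.eq_swap]

lemma isPendant_attachPendants_inl {v : V} (hv : v ∉ S) :
    IsPendant (attachPendants G S s) (Sum.inl v) ↔ IsPendant G v := by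
  unfold IsPendant
  rw [← vertexSum_one, ← vertexSum_one, vertexSum_attachPendants_inl_of_notMem _ hv]
  rfl

lemma isPendant_attachPendants_inr (p : S × Fin s) :
    IsPendant (attachPendants G S s) (Sum.inr p) := by
  unfold IsPendant
  rw [← vertexSum_one, vertexSum_attachPendants_inr]

end AttachPendants

section RowSums

/-- The numbers `0, …, n * s - 1` can be arranged in an `n × s` array with constant row sums if
`n = 1` or `s` is even. -/
lemma exists_equiv_rowSum_eq {n s : ℕ} (h : n = 1 ∨ Even s) :
    ∃ (ℓ : Fin n × Fin s ≃ Fin (n * s)) (R : ℕ), ∀ i, ∑ j, (ℓ (i, j) : ℕ) = R := by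
  obtain rfl | ⟨m, rfl⟩ := h
  · exact ⟨finProdFinEquiv, _, fun i => by rw [Subsingleton.elim i 0]⟩
  · let ℓ : Fin n × Fin (m + m) ≃ Fin (n * (m + m)) :=
      (Equiv.prodCongr (Equiv.refl _) finSumFinEquiv.symm).trans <|
        (Equiv.prodSumDistrib _ _ _).trans <|
          (Equiv.sumCongr finProdFinEquiv (finProdFinEquiv.trans Fin.revPerm)).trans <|
            finSumFinEquiv.trans (finCongr (mul_add n m m).symm)
    have hℓ (i : Fin n) (k : Fin m) :
        (ℓ (i, Fin.castAdd m k) : ℕ) + ℓ (i, Fin.natAdd m k) = 2 * (n * m) - 1 := by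
      have h := (finProdFinEquiv (i, k)).isLt
      have h₁ : (ℓ (i, Fin.castAdd m k) : ℕ) = finProdFinEquiv (i, k) := by
        simp [ℓ, -finProdFinEquiv_apply_val]
      have h₂ : (ℓ (i, Fin.natAdd m k) : ℕ) = n * m + (finProdFinEquiv (i, k)).rev := by
        simp [ℓ, -finProdFinEquiv_apply_val, -Fin.natAdd_eq_addNat]
      rw [h₁, h₂, Fin.val_rev]
      omega
    refine ⟨ℓ, m * (2 * (n * m) - 1), fun i => ?_⟩
    rw [Fin.sum_univ_add, ← Finset.sum_add_distrib, Finset.sum_congr rfl fun k _ => hℓ i k]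
    simp

lemma exists_bijOn_rowSum_eq {α : Type*} (S : Finset α) {s : ℕ} (e : ℕ)
    (h : S.card = 1 ∨ Even s) :
    ∃ (ℓ : S × Fin s → ℕ) (R : ℕ), Set.BijOn ℓ Set.univ (Set.Icc (e + 1) (e + s * S.card)) ∧
      ∀ w, ∑ j, ℓ (w, j) = R := by
  obtain ⟨φ, R, hR⟩ := exists_equiv_rowSum_eq h
  let ψ : S × Fin s ≃ Fin (S.card * s) := (Equiv.prodCongr S.equivFin (Equiv.refl _)).trans φ
  refine ⟨fun p => e + 1 + ψ p, s * (e + 1) + R, ⟨fun p _ => ?_, fun p _ q _ hpq => ?_,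
    fun k hk => ?_⟩, fun w => ?_⟩
  · have := (ψ p).isLt.trans_eq (mul_comm _ _)
    constructor <;> dsimp only <;> omega
  · exact ψ.injective (Fin.ext (Nat.add_left_cancel hpq))
  · obtain ⟨h₁, h₂⟩ := hk
    rw [mul_comm] at h₂
    refine ⟨ψ.symm ⟨k - (e + 1), by omega⟩, Set.mem_univ _, ?_⟩
    simp only [Equiv.apply_symm_apply]
    omega
  · rw [Finset.sum_add_distrib, ← hR (S.equivFin w)]
    simp [ψ]

end RowSums

section StandardSetup

variable [Fintype V] {G : SimpleGraph V} {f : Sym2 V → ℕ} {t r : ℕ} {Vset : ℕ → Finset V}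
  {c : ℕ → ℕ}

lemma StandardSetup.mem_class_one (setup : StandardSetup G f t r Vset c) :
    1 ∈ Finset.Icc 1 t :=
  Finset.mem_Icc.mpr ⟨le_rfl, setup.one_le_r.trans setup.r_le_t⟩

lemma StandardSetup.color_pos (setup : StandardSetup G f t r Vset c) {i : ℕ}
    (hi : i ∈ Finset.Icc 1 t) : 0 < c i := by
  obtain ⟨v, hv⟩ := setup.class_nonempty i hi
  rw [← setup.color_on_class i hi v hv]
  obtain ⟨x, hx⟩ := Finset.card_pos.mp (zero_lt_two.trans_le setup.two_le_card_edges)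
  have : Nontrivial V := by
    induction x using Sym2.ind with
    | _ a b => exact (SimpleGraph.mem_edgeFinset.mp hx : G.Adj a b).nontrivial
  obtain ⟨u, hu⟩ := setup.connected.preconnected.exists_adj_of_nontrivial v
  exact (setup.antimagic.1.mapsTo hu).1.trans (le_vertexSum hu)

/-- Outside the first class, a color is either in the range `c 2, …, c r` or belongs to one of the
pendant singleton classes. -/
lemma StandardSetup.color_cases (setup : StandardSetup G f t r Vset c) {v : V}
    (hv : v ∉ Vset 1) :
    (c 2 ≤ vertexSum G f v ∧ vertexSum G f v ≤ c r) ∨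
      ∃ i ∈ Finset.Icc (r + 1) t, vertexSum G f v = c i ∧ IsPendant G v := by
  obtain ⟨i, hi, hvi⟩ := setup.class_cover v
  have hi' := Finset.mem_Icc.mp hi
  have hne : i ≠ 1 := fun h => hv (h ▸ hvi)
  rw [setup.color_on_class i hi v hvi]
  by_cases hir : i ≤ r
  · left
    constructor
    · obtain h | h := eq_or_lt_of_le (show 2 ≤ i by omega)
      · rw [h]
      · exact (setup.c_strictMono_low 2 i one_le_two h hir).le
    · obtain rfl | h := eq_or_lt_of_le hir
      · rfl
      · exact (setup.c_strictMono_low i r hi'.1 h le_rfl).le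
  · have hmem : i ∈ Finset.Icc (r + 1) t := Finset.mem_Icc.mpr ⟨by omega, hi'.2⟩
    obtain ⟨w, hw, hiw⟩ := setup.pendant_singleton i hmem
    rw [hiw, Finset.mem_singleton] at hvi
    exact Or.inr ⟨i, hmem, rfl, hvi ▸ hw⟩

lemma StandardSetup.le_pendantCount_attachPendants (setup : StandardSetup G f t r Vset c)
    (s : ℕ) :
    s * (Vset 1).card + (t - r) ≤ pendantCount (attachPendants G (Vset 1) s) := by
  have := setup.connected.nonempty
  choose! v hv hVset using setup.pendant_singleton
  have hIcc {i : ℕ} (hi : i ∈ Finset.Icc (r + 1) t) : i ∈ Finset.Icc 1 t ∧ i ≠ 1 := by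
    have := setup.one_le_r
    rw [Finset.mem_Icc] at hi ⊢
    omega
  have hsum {i : ℕ} (hi : i ∈ Finset.Icc (r + 1) t) : vertexSum G f (v i) = c i :=
    setup.color_on_class i (hIcc hi).1 _ (by simp [hVset i hi])
  have hinj : Set.InjOn v (Finset.Icc (r + 1) t : Finset ℕ) := by
    intro i hi j hj hij
    by_contra hne
    refine setup.color_injective i (hIcc hi).1 j (hIcc hj).1 hne ?_
    rw [← hsum hi, ← hsum hj, hij]
  have hcard : (((Finset.Icc (r + 1) t).image v).disjSum
      (Finset.univ : Finset (Vset 1 × Fin s))).card = s * (Vset 1).card + (t - r) := by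
    rw [Finset.card_disjSum, Finset.card_image_of_injOn hinj, Nat.card_Icc, Finset.card_univ,
      Fintype.card_prod, Fintype.card_coe, Fintype.card_fin, mul_comm]
    omega
  rw [← hcard]
  refine Finset.card_le_card fun x hx => Finset.mem_filter.mpr ⟨Finset.mem_univ x, ?_⟩
  obtain ⟨a, ha, rfl⟩ | ⟨p, -, rfl⟩ := Finset.mem_disjSum.mp hx
  · obtain ⟨i, hi, rfl⟩ := Finset.mem_image.mp ha
    refine (isPendant_attachPendants_inl fun h => ?_).mpr (hv i hi)
    refine setup.color_injective i (hIcc hi).1 1 setup.mem_class_one (hIcc hi).2 ?_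
    rw [← hsum hi, setup.color_on_class 1 setup.mem_class_one _ h]
  · exact isPendant_attachPendants_inr p

end StandardSetup

/-- Theorem 2.1(2), first part: in the standard setup with `r ≥ 2`,
if `e + s·n₁ ≥ c_r`, where `s ≥ 1` if `n₁ = 1` and `s ≥ 2` is even if `n₁ ≥ 2`, and
`c₁ ≤ e < c₂`, then `χ_la(G(V₁, s)) = s·n₁ + t - r + 1`. -/
theorem chiLA_attachPendants_V1 [Fintype V] (G : SimpleGraph V)
    (f : Sym2 V → ℕ) (t r : ℕ) (Vset : ℕ → Finset V) (c : ℕ → ℕ)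
    (setup : StandardSetup G f t r Vset c) (hr : 2 ≤ r)
    (e s : ℕ) (he : G.edgeFinset.card = e)
    (hbig : c r ≤ e + s * (Vset 1).card)
    (hs₁ : (Vset 1).card = 1 → 1 ≤ s)
    (hs₂ : 2 ≤ (Vset 1).card → 2 ≤ s ∧ Even s)
    (hce₁ : c 1 ≤ e) (hce₂ : e < c 2) :
    chiLA (attachPendants G (Vset 1) s) = s * (Vset 1).card + (t - r) + 1 := by
  have hpos : 0 < (Vset 1).card := (setup.class_nonempty 1 setup.mem_class_one).card_pos
  have hs : 0 < s * (Vset 1).card := by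
    refine Nat.mul_pos ?_ hpos
    obtain h | h := eq_or_lt_of_le (Nat.succ_le_of_lt hpos)
    · exact hs₁ h.symm
    · have := (hs₂ h).1
      omega
  have hpar : (Vset 1).card = 1 ∨ Even s := by
    obtain h | h := eq_or_lt_of_le (Nat.succ_le_of_lt hpos)
    · exact Or.inl h.symm
    · exact Or.inr (hs₂ h).2
  obtain ⟨ℓ, R, hℓ, hR⟩ := exists_bijOn_rowSum_eq (Vset 1) e hpar
  have hbij : Set.BijOn (extendLabeling f ℓ) (attachPendants G (Vset 1) s).edgeSet
      (Set.Icc 1 (e + s * (Vset 1).card)) :=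
    bijOn_extendLabeling (he ▸ setup.antimagic.1) hℓ (Nat.le_add_right _ _)
  have hcard : (attachPendants G (Vset 1) s).edgeFinset.card = e + s * (Vset 1).card := by
    rw [← SimpleGraph.coe_edgeFinset, ← Finset.coe_Icc] at hbij
    have := Finset.card_nbij _ hbij.mapsTo hbij.injOn hbij.surjOn
    rw [this]
    simp
  have hin {v : V} (hv : v ∈ Vset 1) :
      vertexSum (attachPendants G (Vset 1) s) (extendLabeling f ℓ) (Sum.inl v) = c 1 + R := by
    rw [vertexSum_attachPendants_inl_of_mem _ ⟨v, hv⟩, extendLabeling_comp_map,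
      setup.color_on_class 1 setup.mem_class_one v hv, ← hR ⟨v, hv⟩]
    rfl
  have hout {v : V} (hv : v ∉ Vset 1) :
      vertexSum (attachPendants G (Vset 1) s) (extendLabeling f ℓ) (Sum.inl v) =
        vertexSum G f v := by
    rw [vertexSum_attachPendants_inl_of_notMem _ hv, extendLabeling_comp_map]
  have hnew (p : Vset 1 × Fin s) :
      vertexSum (attachPendants G (Vset 1) s) (extendLabeling f ℓ) (Sum.inr p) = ℓ p :=
    vertexSum_attachPendants_inr _ p
  have hnew_mem (p : Vset 1 × Fin s) := hℓ.mapsTo (Set.mem_univ p)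
  have hlarge : e + s * (Vset 1).card < c 1 + R := by
    obtain ⟨⟨w, j⟩, -, hp⟩ :=
      hℓ.surjOn (⟨by omega, le_rfl⟩ : e + s * (Vset 1).card ∈ Set.Icc (e + 1) _)
    have h₁ : ℓ (w, j) ≤ R :=
      hR w ▸ Finset.single_le_sum (f := fun j => ℓ (w, j)) (fun _ _ => Nat.zero_le _)
        (Finset.mem_univ j)
    have h₂ := setup.color_pos setup.mem_class_one
    omega
  have hout_le {v : V} (hv : v ∉ Vset 1) : vertexSum G f v ≤ e + s * (Vset 1).card := by
    obtain ⟨-, h⟩ | ⟨_, _, _, h⟩ := setup.color_cases hv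
    · exact h.trans hbig
    · have := setup.antimagic.vertexSum_le_of_isPendant h
      omega
  have hlocal : IsLocalAntimagic (attachPendants G (Vset 1) s) (extendLabeling f ℓ) := by
    refine ⟨hcard ▸ hbij, ?_⟩
    rintro (u | p) (v | q) h
    · rw [attachPendants_adj_inl_inl] at h
      have hne := setup.antimagic.2 h
      by_cases hu : u ∈ Vset 1 <;> by_cases hv : v ∈ Vset 1
      · refine absurd ?_ hne
        rw [setup.color_on_class 1 setup.mem_class_one u hu,
          setup.color_on_class 1 setup.mem_class_one v hv]
      · rw [hin hu, hout hv]
        exact ((hout_le hv).trans_lt hlarge).ne'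
      · rw [hout hu, hin hv]
        exact ((hout_le hu).trans_lt hlarge).ne
      · rwa [hout hu, hout hv]
    · rw [attachPendants_adj_inl_inr] at h
      rw [← h, hin q.1.2, hnew]
      exact ((hnew_mem q).2.trans_lt hlarge).ne'
    · rw [attachPendants_adj_inr_inl] at h
      rw [← h, hin p.1.2, hnew]
      exact ((hnew_mem p).2.trans_lt hlarge).ne
    · exact absurd h not_attachPendants_adj_inr_inr
  refine hlocal.chiLA_eq (by omega) ?_ (setup.le_pendantCount_attachPendants s)
  have hsub : Finset.univ.image
      (vertexSum (attachPendants G (Vset 1) s) (extendLabeling f ℓ)) ⊆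
      insert (c 1 + R) (Finset.Icc (e + 1) (e + s * (Vset 1).card) ∪
        (Finset.Icc (r + 1) t).image c) := by
    refine Finset.image_subset_iff.mpr ?_
    rintro (v | p) -
    · by_cases hv : v ∈ Vset 1
      · rw [hin hv]
        exact Finset.mem_insert_self _ _
      · rw [hout hv]
        refine Finset.mem_insert_of_mem (Finset.mem_union.mpr ?_)
        obtain ⟨h, -⟩ | ⟨i, hi, h, -⟩ := setup.color_cases hv
        · exact Or.inl (Finset.mem_Icc.mpr ⟨hce₂.trans_le h, hout_le hv⟩)
        · exact Or.inr (h ▸ Finset.mem_image_of_mem c hi)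
    · rw [hnew]
      exact Finset.mem_insert_of_mem
        (Finset.mem_union_left _ (Finset.mem_Icc.mpr (hnew_mem p)))
  have h₁ := (Finset.card_le_card hsub).trans (Finset.card_insert_le _ _)
  have h₂ := Finset.card_union_le (Finset.Icc (e + 1) (e + s * (Vset 1).card))
    ((Finset.Icc (r + 1) t).image c)
  have h₃ := Finset.card_image_le (s := Finset.Icc (r + 1) t) (f := c)
  rw [Nat.card_Icc] at h₂ h₃
  rw [colorCount]
  omega

end LocalAntimagic
end
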